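/- Let C = H + e be a (k,m)-approximately homogeneous cost with k > 2 and H a k-homogeneous polynomial. For every s₀ > k(k−1)‖H‖_∞/(m−k+1) there is a unique bijection Ψ : 𝓕_H(s₀) → 𝓕_C(s₀) such that for every path x ∈ 𝓕_H(s₀), ‖x(t) − Ψ(x)(t)‖ = O((−t)^{−(m−k+1)/(k−2)}) as t → −∞. -/

import Mathlib

open Filter Asymptotics

noncomputable section

/-- An escape path of the cost `F` at the saddle `0`: a gradient flow path, defined (as a
solution of the ODE) for all sufficiently negative times, converging to `0` at `-∞`. -/
def IsEscapePath {P : ℕ} (F : EuclideanSpace ℝ (Fin P) → ℝ)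
    (x : ℝ → EuclideanSpace ℝ (Fin P)) : Prop :=
  (∃ T : ℝ, ∀ t < T, HasDerivAt x (-(gradient F (x t))) t) ∧
    Tendsto x atBot (nhds 0)

/-- The fast escaping paths of `F` with speed at least `s`, shallow case (`k = 2`):
escape paths with `‖x(t)‖ = O(e^{st})` as `t → -∞`. -/
def FastPathsShallow {P : ℕ} (F : EuclideanSpace ℝ (Fin P) → ℝ) (s : ℝ) :
    Set (ℝ → EuclideanSpace ℝ (Fin P)) :=
  {x | IsEscapePath F x ∧ (fun t => ‖x t‖) =O[atBot] fun t => Real.exp (s * t)}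

/-- The fast escaping paths of `F` with speed at least `s`, deep case (`k > 2`):
escape paths with `‖x(t)‖ ≤ (s (k-2) (T-t))^{-1/(k-2)}` for some `T` and all
sufficiently negative `t`. -/
def FastPathsDeep {P : ℕ} (k : ℕ) (F : EuclideanSpace ℝ (Fin P) → ℝ) (s : ℝ) :
    Set (ℝ → EuclideanSpace ℝ (Fin P)) :=
  {x | IsEscapePath F x ∧ ∃ T : ℝ, ∀ᶠ t in atBot,
      ‖x t‖ ≤ (s * ((k : ℝ) - 2) * (T - t)) ^ (-(1 / ((k : ℝ) - 2)))}

/-- `‖H‖_∞ = max_{‖x‖=1} |H(x)|`. -/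
def supSphere {P : ℕ} (H : EuclideanSpace ℝ (Fin P) → ℝ) : ℝ :=
  sSup ((fun x => |H x|) '' Metric.sphere (0 : EuclideanSpace ℝ (Fin P)) 1)


/-- abstract construction of the bijection from a germ-level correspondence -/
theorem germ_bijection {E : Type} [AddCommGroup E] 
    (S₁ S₂ : Set (ℝ → E)) (Rel : (ℝ → E) → (ℝ → E) → Prop)
    (hsymm : ∀ x y, Rel x y → Rel y x)
    (htrans : ∀ x y z, Rel x y → Rel y z → Rel x z)
    (heq : ∀ x y, x =ᶠ[atBot] y → Rel x y)
    (hS₁ : ∀ x ∈ S₁, ∀ y, y =ᶠ[atBot] x → y ∈ S₁)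
    (hS₂ : ∀ x ∈ S₂, ∀ y, y =ᶠ[atBot] x → y ∈ S₂)
    (hX₁ : ∀ x ∈ S₁, ∃ y ∈ S₂, Rel x y)
    (hX₂ : ∀ y ∈ S₂, ∃ x ∈ S₁, Rel x y)
    (hU₁ : ∀ x ∈ S₁, ∀ y ∈ S₁, Rel x y → x =ᶠ[atBot] y)
    (hU₂ : ∀ x ∈ S₂, ∀ y ∈ S₂, Rel x y → x =ᶠ[atBot] y) :
    ∃ Ψ : (ℝ → E) → (ℝ → E), Set.BijOn Ψ S₁ S₂ ∧ (∀ x ∈ S₁, Rel x (Ψ x)) ∧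
      ∀ Ψ' : (ℝ → E) → (ℝ → E), Set.BijOn Ψ' S₁ S₂ → (∀ x ∈ S₁, Rel x (Ψ' x)) →
        ∀ x ∈ S₁, Ψ' x =ᶠ[atBot] Ψ x := by
  classical
  let rep : (ℝ → E) → (ℝ → E) := fun x => Quotient.out (x : Germ (atBot : Filter ℝ) E)
  have hrep : ∀ x, rep x =ᶠ[atBot] x := by
    intro x
    have : ((rep x : ℝ → E) : Germ (atBot : Filter ℝ) E) = (x : Germ (atBot : Filter ℝ) E) :=
      Quotient.out_eq (x : Germ (atBot : Filter ℝ) E)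
    exact Germ.coe_eq.1 this
  have hrepeq : ∀ x y, x =ᶠ[atBot] y → rep x = rep y := by
    intro x y h
    have : (x : Germ (atBot : Filter ℝ) E) = (y : Germ (atBot : Filter ℝ) E) := Germ.coe_eq.2 h
    simp only [rep, this]
  choose! Y hY hYr using hX₁
  have hrepS : ∀ x ∈ S₁, rep x ∈ S₁ := fun x hx => hS₁ x hx _ (hrep x)
  have hΨe : ∀ x, (x - rep x + Y (rep x)) =ᶠ[atBot] Y (rep x) := by
    intro x
    filter_upwards [hrep x] with t ht
    simp [ht]
  have hΨS : ∀ x ∈ S₁, (x - rep x + Y (rep x)) ∈ S₂ :=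
    fun x hx => hS₂ _ (hY _ (hrepS x hx)) _ (hΨe x)
  have hΨR : ∀ x ∈ S₁, Rel x (x - rep x + Y (rep x)) := by
    intro x hx
    refine htrans _ _ _ (heq _ _ (hrep x).symm) ?_
    exact htrans _ _ _ (hYr _ (hrepS x hx)) (heq _ _ (hΨe x).symm)
  refine ⟨fun x => x - rep x + Y (rep x), ⟨hΨS, ?_, ?_⟩, hΨR, ?_⟩
  · intro x hx x' hx' h
    have h1 : Rel x x' := by
      refine htrans _ _ _ (hΨR x hx) ?_
      simp only at h
      rw [h]
      exact hsymm _ _ (hΨR x' hx')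
    have h2 := hrepeq _ _ (hU₁ x hx x' hx' h1)
    simp only [h2] at h
    simpa using h
  · intro y hy
    obtain ⟨x₀, hx₀, hR⟩ := hX₂ y hy
    have h1 : Rel (Y (rep x₀)) y :=
      htrans _ _ _ (hsymm _ _ (hYr _ (hrepS _ hx₀)))
        (htrans _ _ _ (heq _ _ (hrep x₀)) hR)
    have h2 := hU₂ _ (hY _ (hrepS _ hx₀)) _ hy h1
    have h3 : (y - Y (rep x₀) + rep x₀) =ᶠ[atBot] x₀ := by
      filter_upwards [h2, hrep x₀] with t ht ht'
      simp [ht, ht']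
    refine ⟨y - Y (rep x₀) + rep x₀, hS₁ _ hx₀ _ h3, ?_⟩
    simp only [hrepeq _ _ h3]
    abel
  · intro Ψ' hb hr x hx
    exact hU₂ _ (hb.mapsTo hx) _ (hΨS x hx) (htrans _ _ _ (hsymm _ _ (hr x hx)) (hΨR x hx))

/-- Banach: the norm of a symmetric multilinear form is attained on the diagonal. -/
theorem banach_symm {E : Type} [NormedAddCommGroup E] [InnerProductSpace ℝ E]
    [FiniteDimensional ℝ E] {k : ℕ} (hk : 0 < k)
    (A : ContinuousMultilinearMap ℝ (fun _ : Fin k => E) ℝ)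
    (hA : ∀ (σ : Equiv.Perm (Fin k)) (v : Fin k → E), A (v ∘ σ) = A v)
    (M : ℝ) (hM : 0 ≤ M) (hdiag : ∀ x : E, ‖x‖ = 1 → |A (fun _ => x)| ≤ M) : ‖A‖ ≤ M := by
  rcases subsingleton_or_nontrivial E with hE | hE
  · refine A.opNorm_le_bound hM fun v => ?_
    have : v = 0 := Subsingleton.elim _ _
    subst this
    have : Nonempty (Fin k) := ⟨⟨0, hk⟩⟩
    rw [A.map_zero]
    simp
    positivity
  let S : Set (Fin k → E) := Set.pi Set.univ (fun _ => Metric.sphere (0 : E) 1)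
  have hS : IsCompact S := isCompact_univ_pi fun _ => isCompact_sphere _ _
  have hmS : ∀ v : Fin k → E, v ∈ S ↔ ∀ i, ‖v i‖ = 1 := by
    intro v; simp [S]
  obtain ⟨x₁, hx₁⟩ : ∃ x : E, ‖x‖ = 1 := exists_norm_eq E zero_le_one
  have hne : S.Nonempty := ⟨fun _ => x₁, (hmS _).2 fun _ => hx₁⟩
  have hcA : Continuous fun v : Fin k → E => |A v| := by fun_prop
  obtain ⟨v₀, hv₀, hmax⟩ := hS.exists_isMaxOn hne hcA.continuousOn
  have hnorm : ‖A‖ ≤ |A v₀| := by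
    refine A.opNorm_le_bound (abs_nonneg _) fun v => ?_
    by_cases h0 : ∃ i, v i = 0
    · obtain ⟨i, hi⟩ := h0
      rw [A.map_coord_zero i hi]
      simp only [norm_zero]; positivity
    · push Not at h0
      have h1 : v = fun i => ‖v i‖ • ((‖v i‖)⁻¹ • v i) := by
        funext i
        rw [smul_smul, mul_inv_cancel₀ (norm_ne_zero_iff.2 (h0 i)), one_smul]
      have h2 : A v = (∏ i, ‖v i‖) * A (fun i => (‖v i‖)⁻¹ • v i) := by
        conv_lhs => rw [h1]
        rw [A.map_smul_univ]; rfl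
      rw [h2, norm_mul, Real.norm_of_nonneg (Finset.prod_nonneg fun i _ => norm_nonneg _), mul_comm,
        Real.norm_eq_abs]
      refine mul_le_mul_of_nonneg_right ?_ (Finset.prod_nonneg fun i _ => norm_nonneg _)
      refine hmax ((hmS _).2 fun i => ?_)
      rw [norm_smul, norm_inv, norm_norm, inv_mul_cancel₀ (norm_ne_zero_iff.2 (h0 i))]
  have hle1 : ∀ v ∈ S, |A v| ≤ ‖A‖ := by
    intro v hv
    have := A.le_opNorm v
    rw [hmS] at hv
    simpa [hv] using this
  have hatt : |A v₀| = ‖A‖ := le_antisymm (hle1 _ hv₀) hnorm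
  let K : Set (Fin k → E) := S ∩ {v | |A v| = ‖A‖}
  have hK : IsCompact K := hS.inter_right (isClosed_eq hcA continuous_const)
  have hcs : Continuous fun v : Fin k → E => ‖∑ i, v i‖ := by fun_prop
  obtain ⟨m, ⟨hmS', hmA⟩, hmmax⟩ := hK.exists_isMaxOn ⟨v₀, hv₀, hatt⟩ hcs.continuousOn
  have hm1 := (hmS m).1 hmS'
  simp only [Set.mem_ofPred_eq] at hmA
  have key : ∀ i j, m i = m j := by
    intro i j
    by_contra hij
    have hne : i ≠ j := fun h => hij (by rw [h])
    let U : E → E → (Fin k → E) := fun u v => Function.update (Function.update m i u) j v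
    have hU0 : U (m i) (m j) = m := by
      simp [U]
    set r : E := ∑ l ∈ (Finset.univ.erase i).erase j, m l with hr
    have hsum : ∀ u v, ∑ l, U u v l = u + v + r := by
      intro u v
      have e1 : ∑ l, U u v l = U u v i + (U u v j + ∑ l ∈ (Finset.univ.erase i).erase j, U u v l) := by
        rw [Finset.add_sum_erase _ _ (Finset.mem_erase.2 ⟨hne.symm, Finset.mem_univ _⟩),
          Finset.add_sum_erase _ _ (Finset.mem_univ _)]
      have e2 : ∑ l ∈ (Finset.univ.erase i).erase j, U u v l = r := by
        refine Finset.sum_congr rfl fun l hl => ?_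
        simp only [Finset.mem_erase, Finset.mem_univ, and_true] at hl
        simp [U, hl.1, hl.2]
      rw [e1, e2]
      simp [U, hne]
      abel
    have hprod : ∀ u v, ∏ l, ‖U u v l‖ = ‖u‖ * ‖v‖ := by
      intro u v
      have e1 : ∏ l, ‖U u v l‖ = ‖U u v i‖ * (‖U u v j‖ * ∏ l ∈ (Finset.univ.erase i).erase j, ‖U u v l‖) := by
        rw [Finset.mul_prod_erase _ (fun l => ‖U u v l‖) (Finset.mem_erase.2 ⟨hne.symm, Finset.mem_univ _⟩),
          Finset.mul_prod_erase _ (fun l => ‖U u v l‖) (Finset.mem_univ _)]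
      have e2 : ∏ l ∈ (Finset.univ.erase i).erase j, ‖U u v l‖ = 1 := by
        refine Finset.prod_eq_one fun l hl => ?_
        simp only [Finset.mem_erase, Finset.mem_univ, and_true] at hl
        simp [U, hl.1, hl.2, hm1]
      rw [e1, e2]
      simp [U, hne]
    have hbd : ∀ u v, |A (U u v)| ≤ ‖A‖ * (‖u‖ * ‖v‖) := by
      intro u v
      have := A.le_opNorm (U u v)
      rwa [hprod] at this
    have hUS : ∀ u v, ‖u‖ = 1 → ‖v‖ = 1 → U u v ∈ S := by
      intro u v hu hv
      rw [hmS]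
      intro l
      simp only [U, Function.update_apply]
      split_ifs <;> simp [hu, hv, hm1]
    have hsym : ∀ u v, A (U u v) = A (U v u) := by
      intro u v
      rw [← hA (Equiv.swap i j) (U u v)]
      congr 1
      funext l
      simp only [Function.comp, U, Function.update_apply, Equiv.swap_apply_def]
      split_ifs <;> simp_all
    have hadd2 : ∀ u v w, A (U u (v + w)) = A (U u v) + A (U u w) := by
      intro u v w
      simp only [U, A.map_update_add]
    have hsm2 : ∀ u v (c : ℝ), A (U u (c • v)) = c * A (U u v) := by
      intro u v c
      simp only [U, A.map_update_smul, smul_eq_mul]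
    have hadd1 : ∀ u v w, A (U (v + w) u) = A (U v u) + A (U w u) := by
      intro u v w
      rw [hsym, hadd2, hsym u v, hsym u w]
    have hsm1 : ∀ u v (c : ℝ), A (U (c • v) u) = c * A (U v u) := by
      intro u v c
      rw [hsym, hsm2, hsym]
    have hneg1 : ∀ u v, A (U (-v) u) = - A (U v u) := by
      intro u v
      have := hsm1 u v (-1)
      simpa using this
    have hneg2 : ∀ u v, A (U u (-v)) = - A (U u v) := by
      intro u v
      have := hsm2 u v (-1)
      simpa using this
    have hmx : ∀ u v, ‖u‖ = 1 → ‖v‖ = 1 → |A (U u v)| = ‖A‖ →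
        ‖u + v + r‖ ≤ ‖m i + m j + r‖ := by
      intro u v hu hv h
      have := hmmax (show U u v ∈ K from ⟨hUS u v hu hv, h⟩)
      simp only [Set.mem_ofPred_eq] at this
      rw [hsum] at this
      rwa [← hsum (m i) (m j), hU0]
    set a := m i with ha
    set b := m j with hb
    have ha1 : ‖a‖ = 1 := hm1 i
    have hb1 : ‖b‖ = 1 := hm1 j
    have hAab : |A (U a b)| = ‖A‖ := by rw [hU0]; exact hmA
    by_cases hs : a + b = 0
    · have hba : b = -a := by rw [eq_neg_iff_add_eq_zero, add_comm]; exact hs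
      rw [hba] at hmx hAab
      have t1 := hmx a a ha1 ha1 (by rw [hneg2, abs_neg] at hAab; exact hAab)
      have t2 := hmx (-a) (-a) (by simpa) (by simpa) (by rw [hneg1]; rw [abs_neg]; exact hAab)
      have t3 := pow_le_pow_left₀ (norm_nonneg _) t1 2
      have t4 := pow_le_pow_left₀ (norm_nonneg _) t2 2
      rw [show a + a + r = (2:ℝ) • a + r by rw [two_smul], show a + -a + r = r by abel,
        norm_add_sq_real, norm_smul, ha1, inner_smul_left] at t3
      rw [show -a + -a + r = (-2:ℝ) • a + r by rw [neg_smul, two_smul]; abel, show a + -a + r = r by abel,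
        norm_add_sq_real, norm_smul, ha1, inner_smul_left] at t4
      norm_num at t3 t4
      linarith
    · have hsn : 0 < ‖a + b‖ := norm_pos_iff.2 hs
      have hpar := parallelogram_law_with_norm ℝ a b
      rw [ha1, hb1] at hpar
      have hdn : 0 < ‖a - b‖ := norm_pos_iff.2 (sub_ne_zero.2 hij)
      have hs2 : ‖a + b‖ < 2 := by nlinarith
      have h4 : 4 * A (U a b) = A (U (a+b) (a+b)) - A (U (a-b) (a-b)) := by
        simp only [sub_eq_add_neg, hadd1, hadd2, hneg1, hneg2]
        rw [hsym b a]; ring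
      have hd := hbd (a-b) (a-b)
      have hssl : ‖A‖ * (‖a+b‖ * ‖a+b‖) ≤ |A (U (a+b) (a+b))| := by
        have : 4 * ‖A‖ ≤ |A (U (a+b) (a+b))| + |A (U (a-b) (a-b))| := by
          rw [← hAab, show (4:ℝ) * |A (U a b)| = |4 * A (U a b)| by rw [abs_mul]; norm_num, h4]
          exact abs_sub _ _
        have h5 : ‖A‖ * (‖a + b‖ ^ 2 + ‖a - b‖ ^ 2) = ‖A‖ * 4 := by rw [hpar]; norm_num
        nlinarith
      set w := (‖a+b‖)⁻¹ • (a+b) with hw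
      have hw1 : ‖w‖ = 1 := by
        rw [hw, norm_smul, norm_inv, norm_norm, inv_mul_cancel₀ hsn.ne']
      have hww : |A (U w w)| = ‖A‖ := by
        apply le_antisymm
        · have := hbd w w
          simpa [hw1] using this
        · rw [hw, hsm1, hsm2, abs_mul, abs_mul, abs_inv, abs_norm]
          rw [← mul_assoc, ← mul_inv, mul_comm, ← div_eq_mul_inv, le_div_iff₀ (by positivity)]
          exact hssl
      have t1 := pow_le_pow_left₀ (norm_nonneg _) (hmx w w hw1 hw1 hww) 2
      have t2 := pow_le_pow_left₀ (norm_nonneg _) (hmx (-a) (-b) (by simpa) (by simpa) (by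
        rw [hneg1, hneg2]; simpa using hAab)) 2
      rw [show -a + -b + r = -(a+b) + r by abel, norm_add_sq_real, norm_add_sq_real, norm_neg, inner_neg_left] at t2
      have hin : 0 ≤ inner ℝ (a+b) r := by linarith
      rw [show w + w + r = (2 * (‖a+b‖)⁻¹) • (a+b) + r by rw [hw, ← two_smul ℝ, smul_smul],
        norm_add_sq_real, norm_add_sq_real, norm_smul, inner_smul_left] at t1
      have hn2 : ‖2 * ‖a + b‖⁻¹‖ * ‖a + b‖ = 2 := by
        rw [Real.norm_of_nonneg (by positivity), mul_assoc, inv_mul_cancel₀ hsn.ne', mul_one]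
      rw [hn2] at t1
      have h1le : 1 ≤ 2 * ‖a + b‖⁻¹ := by
        rw [← div_eq_mul_inv, le_div_iff₀ hsn]; linarith
      simp only [conj_trivial] at t1
      nlinarith
  have hconst : m = fun _ => m ⟨0, hk⟩ := by
    funext i; exact key _ _
  rw [← hmA, hconst]
  exact hdiag _ (hm1 _)

/-- A smooth positively homogeneous function of degree `n` is its `n`-th Taylor term. -/
theorem homog_taylor {E F : Type} [NormedAddCommGroup E] [NormedSpace ℝ E]
    [NormedAddCommGroup F] [NormedSpace ℝ F] (n : ℕ) (f : E → F) (hf : ContDiff ℝ (⊤ : ℕ∞) f)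
    (hh : ∀ α : ℝ, 0 < α → ∀ x, f (α • x) = α ^ n • f x) (x : E) :
    iteratedFDeriv ℝ n f 0 (fun _ => x) = (n.factorial : ℝ) • f x := by
  let L : ℝ →L[ℝ] E := ContinuousLinearMap.toSpanSingleton ℝ x
  have hg : ContDiff ℝ (⊤ : ℕ∞) (f ∘ L) := hf.comp L.contDiff
  have h1 : ∀ t, iteratedDeriv n (f ∘ L) t = iteratedFDeriv ℝ n f (t • x) (fun _ => x) := by
    intro t
    rw [iteratedDeriv_eq_iteratedFDeriv, L.iteratedFDeriv_comp_right hf t (i := n) (by exact_mod_cast le_top)]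
    simp [L, ContinuousMultilinearMap.compContinuousLinearMap_apply]
  have h2 : ∀ t : ℝ, 0 < t → iteratedDeriv n (f ∘ L) t = (n.factorial : ℝ) • f x := by
    intro t ht
    have : (f ∘ L) =ᶠ[nhds t] fun s => s ^ n • f x := by
      filter_upwards [lt_mem_nhds ht] with s hs
      simp [L, hh s hs]
    rw [this.iteratedDeriv_eq, iteratedDeriv_smul_const (by fun_prop)]
    simp [iteratedDeriv_pow, Nat.descFactorial_self]
  have hc : Continuous (iteratedDeriv n (f ∘ L)) := hg.continuous_iteratedDeriv n (by exact_mod_cast le_top)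
  have h3 : iteratedDeriv n (f ∘ L) 0 = (n.factorial : ℝ) • f x := by
    have t1 : Tendsto (iteratedDeriv n (f ∘ L)) (nhdsWithin 0 (Set.Ioi 0)) (nhds (iteratedDeriv n (f ∘ L) 0)) :=
      (hc.tendsto 0).mono_left nhdsWithin_le_nhds
    have t2 : Tendsto (iteratedDeriv n (f ∘ L)) (nhdsWithin 0 (Set.Ioi 0)) (nhds ((n.factorial : ℝ) • f x)) := by
      refine tendsto_const_nhds.congr' ?_
      filter_upwards [self_mem_nhdsWithin] with t ht
      exact (h2 t ht).symm
    exact tendsto_nhds_unique t1 t2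
  rw [← h3, h1, zero_smul]

theorem poly_contDiff {P : ℕ} (p : MvPolynomial (Fin P) ℝ) :
    ContDiff ℝ ⊤ (fun x : EuclideanSpace ℝ (Fin P) => MvPolynomial.eval (fun i => x i) p) := by
  induction p using MvPolynomial.induction_on with
  | C a => simpa using contDiff_const
  | add p q hp hq => simpa using hp.add hq
  | mul_X p i hp =>
    simp only [map_mul, MvPolynomial.eval_X]
    refine hp.mul ?_
    exact contDiff_piLp_apply (p := 2)

theorem supSphere_nonneg {P : ℕ} (H : EuclideanSpace ℝ (Fin P) → ℝ) : 0 ≤ supSphere H := by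
  apply Real.sSup_nonneg
  rintro _ ⟨x, _, rfl⟩
  exact abs_nonneg _

theorem fderiv_bounds_H {P k : ℕ} (hk : 2 < k) (H : EuclideanSpace ℝ (Fin P) → ℝ)
    (hH : ContDiff ℝ ⊤ H)
    (hhom : ∀ α : ℝ, 0 < α → ∀ θ : EuclideanSpace ℝ (Fin P), H (α • θ) = α ^ k * H θ) :
    (∀ u, ‖fderiv ℝ H u‖ ≤ k * supSphere H * ‖u‖ ^ (k - 1)) ∧
    ∀ u v, ‖fderiv ℝ H u - fderiv ℝ H v‖ ≤
      k * (k - 1) * supSphere H * max ‖u‖ ‖v‖ ^ (k - 2) * ‖u - v‖ := by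
  obtain ⟨n, rfl⟩ : ∃ n, k = n + 1 := ⟨k - 1, by omega⟩
  have hH' : ContDiff ℝ (⊤ : ℕ∞) H := hH.of_le le_top
  have hn : ‖iteratedFDeriv ℝ (n + 1) H 0‖ ≤ (n + 1).factorial * supSphere H := by
    refine banach_symm (Nat.succ_pos n) _ (fun σ v => hH.contDiffAt.iteratedFDeriv_comp_perm v σ) _
      (mul_nonneg (by positivity) (supSphere_nonneg H)) ?_
    intro x hx
    rw [homog_taylor (n + 1) H hH' hhom x, smul_eq_mul, abs_mul, abs_of_nonneg (by positivity)]
    gcongr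
    refine le_csSup ?_ ⟨x, by simpa using hx, rfl⟩
    exact ((isCompact_sphere _ _).image (by have := hH.continuous; fun_prop)).bddAbove
  have hd : ContDiff ℝ (⊤ : ℕ∞) (fderiv ℝ H) := hH'.fderiv_right (by simp)
  have hhd : ∀ α : ℝ, 0 < α → ∀ x, fderiv ℝ H (α • x) = α ^ n • fderiv ℝ H x := by
    intro α hα x
    have h1 := fderiv_comp_smul (𝕜 := ℝ) (f := H) (x := x) α
    have h2 : (fun x => H (α • x)) = α ^ (n + 1) • H := by
      funext x; simp [hhom α hα]
    rw [h2, fderiv_const_smul (hH'.differentiable (by simp) x)] at h1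
    have h3 : α • fderiv ℝ H (α • x) = α • (α ^ n • fderiv ℝ H x) := by
      rw [← h1, smul_smul, pow_succ']
    exact smul_right_injective _ hα.ne' h3
  set A := iteratedFDeriv ℝ n (fderiv ℝ H) 0 with hA
  have hAn : ‖A‖ ≤ (n + 1).factorial * supSphere H := by
    rw [hA, norm_iteratedFDeriv_fderiv]; exact hn
  have hT : ∀ x, fderiv ℝ H x = (n.factorial : ℝ)⁻¹ • A (fun _ => x) := by
    intro x
    rw [hA, homog_taylor n _ hd hhd x, smul_smul, inv_mul_cancel₀ (by positivity), one_smul]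
  have hf0 : (0:ℝ) < n.factorial := by positivity
  have hAn' : (n.factorial : ℝ)⁻¹ * ‖A‖ ≤ (n + 1) * supSphere H := by
    rw [inv_mul_le_iff₀ hf0]
    refine hAn.trans (le_of_eq ?_)
    rw [Nat.factorial_succ]; push_cast; ring
  constructor
  · intro u
    rw [hT, norm_smul, norm_inv, Real.norm_natCast]
    have := A.le_opNorm (fun _ => u)
    simp only [Finset.prod_const, Finset.card_univ, Fintype.card_fin] at this
    calc (n.factorial : ℝ)⁻¹ * ‖A fun _ => u‖ ≤ (n.factorial : ℝ)⁻¹ * (‖A‖ * ‖u‖ ^ n) := by gcongr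
      _ = ((n.factorial : ℝ)⁻¹ * ‖A‖) * ‖u‖ ^ n := by ring
      _ ≤ ((n + 1) * supSphere H) * ‖u‖ ^ n := by gcongr
      _ = _ := by push_cast; simp
  · intro u v
    rw [hT, hT v, ← smul_sub, norm_smul, norm_inv, Real.norm_natCast]
    have := A.norm_image_sub_le (fun _ => u) (fun _ => v)
    have hne : Nonempty (Fin n) := ⟨⟨0, by omega⟩⟩
    have e1 : ((fun _ => u) - (fun _ => v) : Fin n → EuclideanSpace ℝ (Fin P)) = fun _ => u - v := rfl
    rw [e1, pi_norm_const, pi_norm_const, pi_norm_const, Fintype.card_fin] at this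
    calc (n.factorial : ℝ)⁻¹ * ‖(A fun _ => u) - A fun _ => v‖ 
        ≤ (n.factorial : ℝ)⁻¹ * (‖A‖ * n * max ‖u‖ ‖v‖ ^ (n - 1) * ‖u - v‖) := by gcongr
      _ = ((n.factorial : ℝ)⁻¹ * ‖A‖) * (n * max ‖u‖ ‖v‖ ^ (n - 1) * ‖u - v‖) := by ring
      _ ≤ ((n + 1) * supSphere H) * (n * max ‖u‖ ‖v‖ ^ (n - 1) * ‖u - v‖) := by gcongr
      _ = _ := by push_cast; ring

theorem flat_bound {E : Type} [NormedAddCommGroup E] [NormedSpace ℝ E] [ProperSpace E] (j : ℕ) :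
    ∀ (F : Type) [NormedAddCommGroup F] [NormedSpace ℝ F] (f : E → F)
    (_ : ContDiff ℝ (⊤ : ℕ∞) f) (_ : ∀ n < j, iteratedFDeriv ℝ n f 0 = 0),
    ∃ K : ℝ, 0 ≤ K ∧ ∀ w, ‖w‖ ≤ 1 → ‖f w‖ ≤ K * ‖w‖ ^ j := by
  induction j with
  | zero =>
    intro F _ _ f hf _
    obtain ⟨K, hK⟩ := (isCompact_closedBall (0 : E) 1).exists_bound_of_continuousOn
      hf.continuous.continuousOn
    refine ⟨K, (norm_nonneg _).trans (hK 0 (by simp)), fun w hw => ?_⟩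
    simpa using hK w (by simpa using hw)
  | succ j ih =>
    intro F _ _ f hf h0
    obtain ⟨K, hK0, hK⟩ := ih (E →L[ℝ] F) (fderiv ℝ f) (hf.fderiv_right (by simp)) (by
      intro n hn
      rw [← norm_eq_zero, norm_iteratedFDeriv_fderiv, norm_eq_zero]
      exact h0 _ (by omega))
    refine ⟨K, hK0, fun w hw => ?_⟩
    have hf0 : f 0 = 0 := by
      have := congrArg (fun A => A 0) (h0 0 (by omega))
      simpa using this
    have := Convex.norm_image_sub_le_of_norm_fderiv_le (𝕜 := ℝ) (f := f) (C := K * ‖w‖ ^ j)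
      (s := Metric.closedBall 0 ‖w‖) (x := 0) (y := w)
      (fun x _ => hf.differentiable (by simp) x)
      (by
        intro x hx
        rw [mem_closedBall_zero_iff] at hx
        refine (hK x (hx.trans hw)).trans ?_
        gcongr)
      (convex_closedBall _ _) (by simp) (by simp)
    rw [hf0, sub_zero, sub_zero] at this
    rw [pow_succ, ← mul_assoc]; exact this

theorem fderiv_bounds_e {E : Type} [NormedAddCommGroup E] [NormedSpace ℝ E] [ProperSpace E] {m : ℕ}
    (hm : 3 < m) (e : E → ℝ)
    (hes : ContDiff ℝ (⊤ : ℕ∞) e)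
    (hev : ∀ n : ℕ, n ≤ m - 1 → iteratedFDeriv ℝ n e 0 = 0) :
    fderiv ℝ e 0 = 0 ∧ ∃ K : ℝ, 0 ≤ K ∧ ∀ u v, ‖u‖ ≤ 1 → ‖v‖ ≤ 1 →
      ‖fderiv ℝ e u - fderiv ℝ e v‖ ≤ K * max ‖u‖ ‖v‖ ^ (m - 2) * ‖u - v‖ := by
  have hd : ContDiff ℝ (⊤ : ℕ∞) (fderiv ℝ e) := hes.fderiv_right (by simp)
  have hdd : ContDiff ℝ (⊤ : ℕ∞) (fderiv ℝ (fderiv ℝ e)) := hd.fderiv_right (by simp)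
  constructor
  · have h : iteratedFDeriv ℝ 0 (fderiv ℝ e) 0 = 0 := by
      rw [← norm_eq_zero, norm_iteratedFDeriv_fderiv, norm_eq_zero]
      exact hev _ (by omega)
    have := congrArg (fun A => A 0) h
    simpa using this
  obtain ⟨K, hK0, hK⟩ := flat_bound (m - 2) _ (fderiv ℝ (fderiv ℝ e)) hdd (by
    intro n hn
    rw [← norm_eq_zero, norm_iteratedFDeriv_fderiv, norm_iteratedFDeriv_fderiv, norm_eq_zero]
    exact hev _ (by omega))
  refine ⟨K, hK0, fun u v hu hv => ?_⟩
  refine Convex.norm_image_sub_le_of_norm_fderiv_le (𝕜 := ℝ) (f := fderiv ℝ e)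
      (s := Metric.closedBall 0 (max ‖u‖ ‖v‖))
      (fun x _ => hd.differentiable (by simp) x)
      (by
        intro x hx
        rw [mem_closedBall_zero_iff] at hx
        refine (hK x (hx.trans (max_le hu hv))).trans ?_
        gcongr)
      (convex_closedBall _ _) (by simp) (by simp)

theorem decay_unique {E : Type} [NormedAddCommGroup E] [InnerProductSpace ℝ E]
    (δ δ' : ℝ → E) (N c p R : ℝ) (hN : 0 < N) (hcp : c < p)
    (hd : ∀ s, N < s → HasDerivAt δ (δ' s) s)
    (hb : ∀ s, N < s → ‖δ' s‖ ≤ c / s * ‖δ s‖)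
    (hR : ∀ s, N < s → ‖δ s‖ ≤ R * s ^ (-p)) : ∀ s, N < s → δ s = 0 := by
  let φ : ℝ → ℝ := fun s => ‖δ s‖ ^ 2 * s ^ (2 * c)
  have hφd : ∀ s, N < s → HasDerivAt φ
      (2 * inner ℝ (δ s) (δ' s) * s ^ (2 * c) + ‖δ s‖ ^ 2 * ((2 * c) * s ^ (2 * c - 1))) s := by
    intro s hs
    exact (hd s hs).norm_sq.mul (Real.hasDerivAt_rpow_const (Or.inl (hN.trans hs).ne'))
  have hmono : MonotoneOn φ (Set.Ioi N) := by
    refine monotoneOn_of_deriv_nonneg (convex_Ioi N)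
      (fun s hs => (hφd s hs).continuousAt.continuousWithinAt) ?_ ?_
    · intro s hs
      rw [interior_Ioi] at hs
      exact (hφd s hs).differentiableAt.differentiableWithinAt
    · intro s hs
      rw [interior_Ioi] at hs
      rw [(hφd s hs).deriv]
      have hs0 : 0 < s := hN.trans hs
      have h1 : -(c / s * ‖δ s‖ ^ 2) ≤ inner ℝ (δ s) (δ' s) := by
        have := abs_real_inner_le_norm (δ s) (δ' s)
        have h2 := neg_abs_le (inner ℝ (δ s) (δ' s))
        have h3 := mul_le_mul_of_nonneg_left (hb s hs) (norm_nonneg (δ s))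
        nlinarith
      have h2 : s ^ (2 * c - 1) = s ^ (2 * c) / s := Real.rpow_sub_one hs0.ne' _
      have h3 : 0 < s ^ (2 * c) := by positivity
      have h4 : 2 * inner ℝ (δ s) (δ' s) * s ^ (2 * c) + ‖δ s‖ ^ 2 * ((2 * c) * s ^ (2 * c - 1))
        = 2 * s ^ (2 * c) * (inner ℝ (δ s) (δ' s) + c / s * ‖δ s‖ ^ 2) := by
        rw [h2]; ring
      rw [h4]
      apply mul_nonneg (by positivity); linarith
  intro s hs
  have hup : ∀ u, N < u → φ u ≤ R ^ 2 * u ^ (-(2 * (p - c))) := by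
    intro u hu
    have hu0 : 0 < u := hN.trans hu
    have h1 := pow_le_pow_left₀ (norm_nonneg _) (hR u hu) 2
    calc φ u ≤ (R * u ^ (-p)) ^ 2 * u ^ (2 * c) := by simp only [φ]; gcongr
      _ = R ^ 2 * (u ^ (-p) * u ^ (-p) * u ^ (2 * c)) := by ring
      _ = _ := by rw [← Real.rpow_add hu0, ← Real.rpow_add hu0]; ring_nf
  have hlim : Tendsto (fun u : ℝ => R ^ 2 * u ^ (-(2 * (p - c)))) atTop (nhds 0) := by
    simpa using (tendsto_rpow_neg_atTop (show 0 < 2 * (p - c) by linarith)).const_mul (R ^ 2)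
  have hle : φ s ≤ 0 := by
    refine ge_of_tendsto hlim ?_
    filter_upwards [eventually_ge_atTop s] with u hu
    exact (hmono hs (lt_of_lt_of_le hs hu) hu).trans (hup u (lt_of_lt_of_le hs hu))
  have hs0 : 0 < s := hN.trans hs
  have h3 : 0 < s ^ (2 * c) := by positivity
  have h5 : ‖δ s‖ ^ 2 ≤ 0 := by
    by_contra h
    push Not at h
    have : 0 < φ s := mul_pos h h3
    linarith
  have : ‖δ s‖ = 0 := by nlinarith [norm_nonneg (δ s)]
  simpa using this

theorem tail_facts {E : Type} [NormedAddCommGroup E] [NormedSpace ℝ E] [CompleteSpace E]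
    (J : ℝ → E) (hJ : Continuous J) (N p K : ℝ) (hN : 0 < N) (hp : 0 < p)
    (hb : ∀ u, N ≤ u → ‖J u‖ ≤ K * u ^ (-p - 1)) :
    (∀ t, N ≤ t → ‖(∫ u in Set.Ioi N, J u) - ∫ u in N..t, J u‖ ≤ K / p * t ^ (-p)) ∧
      MeasureTheory.IntegrableOn J (Set.Ioi N) := by
  have hIntble : ∀ t, N ≤ t → MeasureTheory.IntegrableOn (fun u : ℝ => K * u ^ (-p - 1)) (Set.Ioi t) := by
    intro t ht
    exact (integrableOn_Ioi_rpow_of_lt (by linarith) (hN.trans_le ht)).const_mul K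
  have hJi : ∀ t, N ≤ t → MeasureTheory.IntegrableOn J (Set.Ioi t) := by
    intro t ht
    refine (hIntble t ht).mono' hJ.aestronglyMeasurable ?_
    refine (MeasureTheory.ae_restrict_iff' measurableSet_Ioi).2 (Eventually.of_forall ?_)
    intro u hu
    exact hb u (ht.trans hu.le)
  refine ⟨fun t ht => ?_, hJi N le_rfl⟩
  have h1 : (∫ u in Set.Ioi N, J u) - ∫ u in N..t, J u = ∫ u in Set.Ioi t, J u := by
    rw [← intervalIntegral.integral_interval_add_Ioi (hJi N le_rfl) (hJi t ht)]
    abel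
  rw [h1]
  have h2 : ‖∫ u in Set.Ioi t, J u‖ ≤ ∫ u in Set.Ioi t, K * u ^ (-p - 1) := by
    refine MeasureTheory.norm_integral_le_of_norm_le (hIntble t ht) ?_
    refine (MeasureTheory.ae_restrict_iff' measurableSet_Ioi).2 (Eventually.of_forall ?_)
    intro u hu
    exact hb u (ht.trans hu.le)
  refine h2.trans (le_of_eq ?_)
  rw [MeasureTheory.integral_const_mul, integral_Ioi_rpow_of_lt (by linarith) (hN.trans_le ht)]
  rw [show -p - 1 + 1 = -p by ring]
  field_simp

open BoundedContinuousFunction in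
theorem fixed_point_ode {E : Type} [NormedAddCommGroup E] [NormedSpace ℝ E] [CompleteSpace E]
    (I : ℝ → E → E) (N c p D R : ℝ) (hN : 0 < N) (hc : 0 ≤ c) (hcp : c < p) (hR : 0 ≤ R)
    (hDR : D + c * R ≤ p * R)
    (hI : ContinuousOn (Function.uncurry I) (Set.Ici N ×ˢ Set.univ))
    (hL : ∀ s, N ≤ s → ∀ d₁ d₂ : E, ‖d₁‖ ≤ R * s ^ (-p) → ‖d₂‖ ≤ R * s ^ (-p) →
      ‖I s d₁ - I s d₂‖ ≤ c / s * ‖d₁ - d₂‖)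
    (h0 : ∀ s, N ≤ s → ‖I s 0‖ ≤ D * s ^ (-p - 1)) :
    ∃ d : ℝ → E, (∀ s, N < s → HasDerivAt d (-(I s (d s))) s) ∧
      ∀ s, N ≤ s → ‖d s‖ ≤ R * s ^ (-p) := by
  have hp : 0 < p := by linarith
  let J : (ℝ →ᵇ E) → ℝ → E := fun z u => I (max u N) ((max u N) ^ (-p) • z (max u N))
  have hJc : ∀ z, Continuous (J z) := by
    intro z
    have h1 : Continuous fun u : ℝ => (max u N) ^ (-p) := by
      refine Continuous.rpow_const (by fun_prop) fun u => Or.inl ?_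
      exact (lt_of_lt_of_le hN (le_max_right _ _)).ne'
    have h2 : Continuous fun u : ℝ => ((max u N, (max u N) ^ (-p) • z (max u N)) : ℝ × E) := by
      have := z.continuous
      fun_prop
    have := hI.comp_continuous h2 (by intro u; simp)
    exact this
  have hJe : ∀ z u, N ≤ u → J z u = I u (u ^ (-p) • z u) := by
    intro z u hu
    simp only [J, max_eq_left hu]
  have hpw : ∀ s : ℝ, N ≤ s → s ^ (-p - 1) = s ^ (-p) / s := fun s hs =>
    Real.rpow_sub_one (hN.trans_le hs).ne' _
  have hsm : ∀ (z : ℝ →ᵇ E) s, N ≤ s → ‖s ^ (-p) • z s‖ ≤ ‖z‖ * s ^ (-p) := by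
    intro z s hs
    have hs0 := hN.trans_le hs
    rw [norm_smul, Real.norm_of_nonneg (by positivity), mul_comm]
    gcongr
    exact z.norm_coe_le_norm s
  have hJd : ∀ z w : ℝ →ᵇ E, ‖z‖ ≤ R → ‖w‖ ≤ R → ∀ s, N ≤ s →
      ‖J z s - J w s‖ ≤ (c * ‖z - w‖) * s ^ (-p - 1) := by
    intro z w hz hw s hs
    have hs0 := hN.trans_le hs
    rw [hJe z s hs, hJe w s hs]
    refine (hL s hs _ _ ((hsm z s hs).trans (by gcongr)) ((hsm w s hs).trans (by gcongr))).trans ?_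
    have := hsm (z - w) s hs
    rw [← smul_sub, hpw s hs]
    calc c / s * ‖s ^ (-p) • (z s - w s)‖ ≤ c / s * (‖z - w‖ * s ^ (-p)) := by
          gcongr; exact this
      _ = _ := by ring
  have hJb : ∀ z : ℝ →ᵇ E, ‖z‖ ≤ R → ∀ s, N ≤ s → ‖J z s‖ ≤ (D + c * R) * s ^ (-p - 1) := by
    intro z hz s hs
    have hs0 := hN.trans_le hs
    have h1 := hJd z 0 hz (by simpa using hR) s hs
    have h2 : J 0 s = I s 0 := by rw [hJe 0 s hs]; simp
    have h3 := h0 s hs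
    rw [sub_zero, h2] at h1
    have h4 : ‖J z s‖ ≤ ‖J z s - I s 0‖ + ‖I s 0‖ := by
      simpa using norm_add_le (J z s - I s 0) (I s 0)
    have h5 : (c * ‖z‖) * s ^ (-p - 1) ≤ (c * R) * s ^ (-p - 1) := by gcongr
    linarith
  let tail : (ℝ →ᵇ E) → ℝ → E := fun z t => (∫ u in Set.Ioi N, J z u) - ∫ u in N..t, J z u
  have htd : ∀ z t, HasDerivAt (tail z) (-(J z t)) t := by
    intro z t
    have := ((hJc z).integral_hasStrictDerivAt N t).hasDerivAt
    simpa using this.const_sub (∫ u in Set.Ioi N, J z u)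
  have htc : ∀ z, Continuous (tail z) := fun z =>
    continuous_iff_continuousAt.2 fun t => (htd z t).continuousAt
  have htb : ∀ z : ℝ →ᵇ E, ‖z‖ ≤ R → ∀ t, N ≤ t → ‖tail z t‖ ≤ R * t ^ (-p) := by
    intro z hz t ht
    have ht0 := hN.trans_le ht
    refine ((tail_facts (J z) (hJc z) N p _ hN hp (hJb z hz)).1 t ht).trans ?_
    gcongr
    rw [div_le_iff₀ hp]; linarith
  have htdiff : ∀ z w : ℝ →ᵇ E, ‖z‖ ≤ R → ‖w‖ ≤ R → ∀ t, N ≤ t →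
      ‖tail z t - tail w t‖ ≤ (c / p * ‖z - w‖) * t ^ (-p) := by
    intro z w hz hw t ht
    have hiz := (tail_facts (J z) (hJc z) N p _ hN hp (hJb z hz)).2
    have hiw := (tail_facts (J w) (hJc w) N p _ hN hp (hJb w hw)).2
    have h1 := (tail_facts (fun u => J z u - J w u) ((hJc z).sub (hJc w)) N p _ hN hp
      (hJd z w hz hw)).1 t ht
    rw [MeasureTheory.integral_sub hiz hiw, intervalIntegral.integral_sub
      ((hJc z).intervalIntegrable _ _) ((hJc w).intervalIntegrable _ _)] at h1
    have h2 : tail z t - tail w t = (∫ u in Set.Ioi N, J z u) - (∫ u in Set.Ioi N, J w u) -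
      ((∫ u in N..t, J z u) - ∫ u in N..t, J w u) := by simp only [tail]; abel
    rw [h2]
    refine h1.trans (le_of_eq (by ring))
  have hpp : ∀ t : ℝ, N ≤ t → t ^ p * t ^ (-p) = 1 := by
    intro t ht
    have ht0 := hN.trans_le ht
    rw [← Real.rpow_add ht0]; simp
  let g : (ℝ →ᵇ E) → ℝ → E := fun z τ => (max τ N) ^ p • tail z (max τ N)
  have hgc : ∀ z, Continuous (g z) := by
    intro z
    have h1 : Continuous fun u : ℝ => (max u N) ^ p := by
      refine Continuous.rpow_const (by fun_prop) fun u => Or.inl ?_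
      exact (lt_of_lt_of_le hN (le_max_right _ _)).ne'
    have := htc z
    fun_prop
  have hgb : ∀ z : ℝ →ᵇ E, ‖z‖ ≤ R → ∀ τ, ‖g z τ‖ ≤ R := by
    intro z hz τ
    have hm : N ≤ max τ N := le_max_right _ _
    have hm0 := hN.trans_le hm
    simp only [g]
    rw [norm_smul, Real.norm_of_nonneg (by positivity)]
    calc (max τ N) ^ p * ‖tail z (max τ N)‖ ≤ (max τ N) ^ p * (R * (max τ N) ^ (-p)) := by
          gcongr; exact htb z hz _ hm
      _ = R * ((max τ N) ^ p * (max τ N) ^ (-p)) := by ring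
      _ = R := by rw [hpp _ hm, mul_one]
  let Φ : Metric.closedBall (0 : ℝ →ᵇ E) R → Metric.closedBall (0 : ℝ →ᵇ E) R := fun z =>
    ⟨BoundedContinuousFunction.ofNormedAddCommGroup (g z.1) (hgc z.1) R
      (hgb z.1 (mem_closedBall_zero_iff.1 z.2)), by
      rw [mem_closedBall_zero_iff]
      exact BoundedContinuousFunction.norm_ofNormedAddCommGroup_le _ hR _⟩
  have hcp1 : 0 ≤ c / p := by positivity
  have hcon : ContractingWith (c / p).toNNReal Φ := by
    constructor
    · rw [Real.toNNReal_lt_one, div_lt_one hp]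
      exact hcp
    · refine LipschitzWith.of_dist_le_mul fun z w => ?_
      rw [Real.coe_toNNReal _ hcp1]
      show dist (Φ z).1 (Φ w).1 ≤ (c / p) * dist z.1 w.1
      rw [BoundedContinuousFunction.dist_le (by positivity)]
      intro τ
      have hm : N ≤ max τ N := le_max_right _ _
      have hm0 := hN.trans_le hm
      show dist (g z.1 τ) (g w.1 τ) ≤ _
      rw [dist_eq_norm, dist_eq_norm]
      simp only [g]
      rw [← smul_sub, norm_smul, Real.norm_of_nonneg (by positivity)]
      calc (max τ N) ^ p * ‖tail z.1 (max τ N) - tail w.1 (max τ N)‖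
          ≤ (max τ N) ^ p * ((c / p * ‖z.1 - w.1‖) * (max τ N) ^ (-p)) := by
            gcongr
            exact htdiff _ _ (mem_closedBall_zero_iff.1 z.2) (mem_closedBall_zero_iff.1 w.2) _ hm
        _ = (c / p * ‖z.1 - w.1‖) * ((max τ N) ^ p * (max τ N) ^ (-p)) := by ring
        _ = _ := by rw [hpp _ hm, mul_one]
  have hcomp : CompleteSpace (Metric.closedBall (0 : ℝ →ᵇ E) R) :=
    Metric.isClosed_closedBall.completeSpace_coe
  have hnon : Nonempty (Metric.closedBall (0 : ℝ →ᵇ E) R) := ⟨⟨0, by simpa using hR⟩⟩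
  obtain ⟨z, hz, -⟩ := hcon.exists_fixedPoint hnon.some (edist_ne_top _ _)
  have hzR : ‖z.1‖ ≤ R := mem_closedBall_zero_iff.1 z.2
  have hfix : ∀ s, N ≤ s → z.1 s = s ^ p • tail z.1 s := by
    intro s hs
    have h1 : (Φ z).1 s = z.1 s := by rw [hz]
    rw [← h1]
    show g z.1 s = _
    simp only [g, max_eq_left hs]
  refine ⟨tail z.1, fun s hs => ?_, htb z.1 hzR⟩
  have h1 : J z.1 s = I s (tail z.1 s) := by
    rw [hJe _ _ hs.le, hfix s hs.le, smul_smul, mul_comm, hpp s hs.le, one_smul]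
  rw [← h1]
  exact htd z.1 s

theorem radius_tendsto (κ : ℕ) (hκ : 0 < κ) (a T R p : ℝ) (ha : 0 < a) (hp : 1 / (κ : ℝ) < p) :
    Tendsto (fun s : ℝ => (a * (T + s)) ^ (-(1 / (κ : ℝ))) + R * s ^ (-p)) atTop (nhds 0) ∧
    Tendsto (fun s : ℝ => s * ((a * (T + s)) ^ (-(1 / (κ : ℝ))) + R * s ^ (-p)) ^ κ) atTop
      (nhds (1 / a)) := by
  have hκ' : (0:ℝ) < κ := by exact_mod_cast hκ
  have hq : 0 < 1 / (κ : ℝ) := by positivity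
  set q := 1 / (κ : ℝ) with hqd
  have hTs : Tendsto (fun s : ℝ => a * (T + s)) atTop atTop :=
    (tendsto_atTop_add_const_left _ T tendsto_id).const_mul_atTop ha
  constructor
  · have h1 := (tendsto_rpow_neg_atTop hq).comp hTs
    have h2 := (tendsto_rpow_neg_atTop (hq.trans hp)).const_mul R
    simpa using h1.add h2
  · have h1 : Tendsto (fun s : ℝ => (a * (T / s + 1)) ^ (-q) + R * s ^ (-(p - q))) atTop
        (nhds (a ^ (-q))) := by
      have t1 : Tendsto (fun s : ℝ => a * (T / s + 1)) atTop (nhds a) := by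
        have : Tendsto (fun s : ℝ => T / s) atTop (nhds 0) := tendsto_const_nhds.div_atTop tendsto_id
        simpa using (this.add_const 1).const_mul a
      have t2 := t1.rpow_const (p := -q) (Or.inl ha.ne')
      have t3 := (tendsto_rpow_neg_atTop (show 0 < p - q by linarith)).const_mul R
      simpa using t2.add t3
    have h2 := h1.pow κ
    have h3 : (a ^ (-q)) ^ κ = 1 / a := by
      rw [← Real.rpow_natCast, ← Real.rpow_mul ha.le, hqd]
      rw [show -(1 / (κ:ℝ)) * κ = -1 by field_simp, Real.rpow_neg_one, one_div]
    rw [h3] at h2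
    refine h2.congr' ?_
    filter_upwards [eventually_gt_atTop 0, eventually_gt_atTop (-T)] with s hs hsT
    have e1 : s = (s ^ q) ^ κ := by
      rw [← Real.rpow_natCast, ← Real.rpow_mul hs.le, hqd, one_div_mul_cancel hκ'.ne', Real.rpow_one]
    have e2 : s * ((a * (T + s)) ^ (-q) + R * s ^ (-p)) ^ κ
        = (s ^ q * ((a * (T + s)) ^ (-q) + R * s ^ (-p))) ^ κ := by
      rw [mul_pow, ← e1]
    rw [e2]
    congr 1
    have hTs0 : 0 < T + s := by linarith
    have e3 : a * (T / s + 1) = (a * (T + s)) * s⁻¹ := by field_simp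
    rw [e3, Real.mul_rpow (by positivity) (by positivity), Real.inv_rpow hs.le, Real.rpow_neg hs.le q,
      inv_inv, show -(p - q) = q + -p by ring, Real.rpow_add hs]
    ring

theorem radius_lip (κ j : ℕ) (hκ : 0 < κ) (hj : κ < j) (a T R p B K c : ℝ) (ha : 0 < a)
    (hp : 1 / (κ : ℝ) < p) (hc : B / a < c) :
    ∀ᶠ s : ℝ in atTop, ∀ r, r = (a * (T + s)) ^ (-(1 / (κ : ℝ))) + R * s ^ (-p) →
      r ≤ 1 ∧ B * r ^ κ + K * r ^ j ≤ c / s := by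
  obtain ⟨h1, h2⟩ := radius_tendsto κ hκ a T R p ha hp
  set r : ℝ → ℝ := fun s => (a * (T + s)) ^ (-(1 / (κ : ℝ))) + R * s ^ (-p) with hr
  have h3 : Tendsto (fun s => B * (s * r s ^ κ) + K * ((s * r s ^ κ) * r s ^ (j - κ))) atTop
      (nhds (B * (1 / a) + K * ((1 / a) * 0 ^ (j - κ)))) :=
    (h2.const_mul B).add ((h2.mul (h1.pow (j - κ))).const_mul K)
  rw [zero_pow (by omega), mul_zero, mul_zero, add_zero, mul_one_div] at h3
  filter_upwards [h1.eventually_le_const zero_lt_one, h3.eventually_le_const hc,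
    eventually_gt_atTop 0] with s hs1 hs2 hs3
  rintro _ rfl
  refine ⟨hs1, ?_⟩
  rw [le_div_iff₀ hs3]
  have : r s ^ j = r s ^ κ * r s ^ (j - κ) := by rw [← pow_add]; congr 1; omega
  have e : (B * r s ^ κ + K * r s ^ j) * s
    = B * (s * r s ^ κ) + K * ((s * r s ^ κ) * r s ^ (j - κ)) := by rw [this]; ring
  calc _ = (B * r s ^ κ + K * r s ^ j) * s := rfl
    _ ≤ c := by rw [e]; exact hs2

theorem fast_bigO (q a T : ℝ) (hq : 0 < q) (ha : 0 < a) :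
    ∀ᶠ s : ℝ in atTop, (a * (T + s)) ^ (-q) ≤ (a / 2) ^ (-q) * s ^ (-q) := by
  filter_upwards [eventually_gt_atTop 0, eventually_ge_atTop (-2 * T)] with s hs hsT
  rw [← Real.mul_rpow (by positivity) hs.le]
  refine Real.rpow_le_rpow_of_nonpos (by positivity) ?_ (by linarith)
  nlinarith

theorem fast_perturb (q a T R p : ℝ) (hq : 0 < q) (ha : 0 < a) (hp : q + 1 ≤ p) (hR : 0 ≤ R) :
    ∃ T' : ℝ, ∀ᶠ s : ℝ in atTop,
      (a * (T + s)) ^ (-q) + R * s ^ (-p) ≤ (a * (T' + s)) ^ (-q) := by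
  set Δ : ℝ := R * (a ^ (-q))⁻¹ * 2 ^ (q + 1) / q with hΔ
  have haq : 0 < a ^ (-q) := by positivity
  have hΔ0 : 0 ≤ Δ := by positivity
  refine ⟨T - Δ, ?_⟩
  filter_upwards [eventually_ge_atTop 1, eventually_gt_atTop (-T), eventually_gt_atTop (Δ - T),
    eventually_ge_atTop T] with s hs1 hs2 hs3 hs4
  have hs0 : 0 < s := by linarith
  have hu : 0 < T + s := by linarith
  set u := T + s with hud
  have hud' : T - Δ + s = u * (1 - Δ / u) := by field_simp; rw [hud]; ring
  have h1 : 0 < 1 - Δ / u := by rw [sub_pos, div_lt_one hu]; linarith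
  rw [hud', Real.mul_rpow ha.le hu.le, Real.mul_rpow ha.le (by positivity), Real.mul_rpow hu.le h1.le]
  have h2 : 1 + q * (Δ / u) ≤ (1 - Δ / u) ^ (-q) := by
    rw [Real.rpow_def_of_pos h1]
    have t1 : Real.log (1 - Δ / u) ≤ - (Δ / u) := by
      have := Real.log_le_sub_one_of_pos h1; linarith
    have t2 := Real.add_one_le_exp (Real.log (1 - Δ / u) * -q)
    nlinarith
  have h3 : s ^ (-p) ≤ s ^ (-(q + 1)) := Real.rpow_le_rpow_of_exponent_le hs1 (by linarith)
  have h4 : s ^ (-(q + 1)) ≤ 2 ^ (q + 1) * u ^ (-(q + 1)) := by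
    have t1 : (2 * s) ^ (-(q + 1)) ≤ u ^ (-(q + 1)) :=
      Real.rpow_le_rpow_of_nonpos hu (by linarith) (by linarith)
    rw [Real.mul_rpow (by norm_num) hs0.le, Real.rpow_neg (by norm_num)] at t1
    have t2 : (0:ℝ) < 2 ^ (q + 1) := by positivity
    rwa [inv_mul_le_iff₀ t2] at t1
  have h5 : u ^ (-(q + 1)) = u ^ (-q) / u := by
    rw [show -(q + 1) = -q - 1 by ring, Real.rpow_sub_one hu.ne']
  have h6 : R * s ^ (-p) ≤ a ^ (-q) * (u ^ (-q) * (q * (Δ / u))) := by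
    calc R * s ^ (-p) ≤ R * (2 ^ (q + 1) * (u ^ (-q) / u)) := by
          rw [← h5]; gcongr; exact h3.trans h4
      _ = _ := by rw [hΔ]; field_simp
  have huq : 0 < u ^ (-q) := by positivity
  calc a ^ (-q) * u ^ (-q) + R * s ^ (-p)
      ≤ a ^ (-q) * u ^ (-q) + a ^ (-q) * (u ^ (-q) * (q * (Δ / u))) := by gcongr
    _ = a ^ (-q) * (u ^ (-q) * (1 + q * (Δ / u))) := by ring
    _ ≤ _ := by gcongr

theorem path_unique {E : Type} [NormedAddCommGroup E] [InnerProductSpace ℝ E]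
    (κ j : ℕ) (hκ : 0 < κ) (hj : κ < j) (g : E → E) (X Y : ℝ → E) (a T₁ T₂ R p B K : ℝ)
    (ha : 0 < a) (hBp : B / a < p) (hB : 0 ≤ B) (hK : 0 ≤ K)
    (hX : ∀ᶠ s in atTop, HasDerivAt X (g (X s)) s) (hY : ∀ᶠ s in atTop, HasDerivAt Y (g (Y s)) s)
    (hXb : ∀ᶠ s in atTop, ‖X s‖ ≤ (a * (T₁ + s)) ^ (-(1 / (κ : ℝ))))
    (hYb : ∀ᶠ s in atTop, ‖Y s‖ ≤ (a * (T₂ + s)) ^ (-(1 / (κ : ℝ))))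
    (hXY : ∀ᶠ s in atTop, ‖X s - Y s‖ ≤ R * s ^ (-p))
    (hg : ∀ᶠ s in atTop, ‖X s‖ ≤ 1 → ‖Y s‖ ≤ 1 → ‖g (X s) - g (Y s)‖ ≤
      (B * max ‖X s‖ ‖Y s‖ ^ κ + K * max ‖X s‖ ‖Y s‖ ^ j) * ‖X s - Y s‖) :
    ∀ᶠ s in atTop, X s = Y s := by
  obtain ⟨c, hc1, hc2⟩ := exists_between hBp
  have hq : 0 < 1 / (κ : ℝ) := by positivity
  have hr := radius_lip κ j hκ hj a (min T₁ T₂) 0 (1 / (κ : ℝ) + 1) B K c ha (by linarith) hc1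
  have hev : ∀ᶠ s in atTop, 0 < s ∧ HasDerivAt (fun s => X s - Y s) (g (X s) - g (Y s)) s ∧
      ‖g (X s) - g (Y s)‖ ≤ c / s * ‖X s - Y s‖ ∧ ‖X s - Y s‖ ≤ R * s ^ (-p) := by
    filter_upwards [hX, hY, hXb, hYb, hXY, hg, hr, eventually_gt_atTop 0,
      eventually_gt_atTop (-(min T₁ T₂))] with s h1 h2 h3 h4 h5 h6 h7 h8 h9
    refine ⟨h8, h1.sub h2, ?_, h5⟩
    obtain ⟨h71, h72⟩ := h7 _ rfl
    set r := (a * (min T₁ T₂ + s)) ^ (-(1 / (κ : ℝ))) + 0 * s ^ (-(1 / (κ : ℝ) + 1)) with hrd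
    have hpos : 0 < a * (min T₁ T₂ + s) := by
      apply mul_pos ha; linarith
    have hX' : ‖X s‖ ≤ r := by
      refine h3.trans ?_
      rw [hrd, zero_mul, add_zero]
      refine Real.rpow_le_rpow_of_nonpos hpos ?_ (by linarith)
      gcongr; exact min_le_left _ _
    have hY' : ‖Y s‖ ≤ r := by
      refine h4.trans ?_
      rw [hrd, zero_mul, add_zero]
      refine Real.rpow_le_rpow_of_nonpos hpos ?_ (by linarith)
      gcongr; exact min_le_right _ _
    refine (h6 (hX'.trans h71) (hY'.trans h71)).trans ?_
    gcongr
    refine le_trans ?_ h72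
    have hm : max ‖X s‖ ‖Y s‖ ≤ r := max_le hX' hY'
    gcongr
  obtain ⟨N, hN⟩ := eventually_atTop.1 hev
  have hN0 := (hN N le_rfl).1
  have := decay_unique (fun s => X s - Y s) (fun s => g (X s) - g (Y s)) N c p R hN0 hc2
    (fun s hs => (hN s hs.le).2.1) (fun s hs => (hN s hs.le).2.2.1) (fun s hs => (hN s hs.le).2.2.2)
  filter_upwards [eventually_gt_atTop N] with s hs
  exact sub_eq_zero.1 (this s hs)

theorem path_exists {E : Type} [NormedAddCommGroup E] [NormedSpace ℝ E] [CompleteSpace E]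
    (κ j n : ℕ) (hκ : 0 < κ) (hj : κ < j) (f g : E → E) (X : ℝ → E) (a T p B K K' : ℝ)
    (ha : 0 < a) (hp : 1 / (κ : ℝ) < p) (hpn : p + 1 = 1 / (κ : ℝ) * n)
    (hBp : B / a < p) (hB : 0 ≤ B) (hK : 0 ≤ K) (hK' : 0 ≤ K')
    (hfc : Continuous f) (hgc : Continuous g)
    (hX : ∀ᶠ s in atTop, HasDerivAt X (f (X s)) s)
    (hXb : ∀ᶠ s in atTop, ‖X s‖ ≤ (a * (T + s)) ^ (-(1 / (κ : ℝ))))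
    (hfg : ∀ u, ‖u‖ ≤ 1 → ‖f u - g u‖ ≤ K' * ‖u‖ ^ n)
    (hg : ∀ u v, ‖u‖ ≤ 1 → ‖v‖ ≤ 1 → ‖g u - g v‖ ≤
      (B * max ‖u‖ ‖v‖ ^ κ + K * max ‖u‖ ‖v‖ ^ j) * ‖u - v‖) :
    ∃ (Y : ℝ → E) (R : ℝ), 0 ≤ R ∧ (∀ᶠ s in atTop, HasDerivAt Y (g (Y s)) s) ∧
      ∀ᶠ s in atTop, ‖Y s - X s‖ ≤ R * s ^ (-p) := by
  obtain ⟨c, hc1, hc2⟩ := exists_between hBp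
  have hq : 0 < 1 / (κ : ℝ) := by positivity
  have hc0 : 0 ≤ c := le_trans (by positivity) hc1.le
  set q := 1 / (κ : ℝ) with hqd
  set A : ℝ := (a / 2) ^ (-q) with hA
  have hA0 : 0 < A := by positivity
  set D : ℝ := K' * A ^ n with hD
  have hD0 : 0 ≤ D := by positivity
  set R : ℝ := D / (p - c) with hR
  have hpc : 0 < p - c := by linarith
  have hR0 : 0 ≤ R := by positivity
  have hDR : D + c * R ≤ p * R := by
    have : (p - c) * R = D := by rw [hR]; field_simp
    linarith
  have hr := radius_lip κ j hκ hj a T R p B K c ha hp hc1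
  rw [← hqd] at hr
  have hev : ∀ᶠ s in atTop, 0 < s ∧ HasDerivAt X (f (X s)) s ∧ ‖X s‖ ≤ (a * (T + s)) ^ (-q) ∧
      (a * (T + s)) ^ (-q) ≤ A * s ^ (-q) ∧
      ∀ r, r = (a * (T + s)) ^ (-q) + R * s ^ (-p) →
      r ≤ 1 ∧ B * r ^ κ + K * r ^ j ≤ c / s := by
    filter_upwards [hX, hXb, hr, eventually_gt_atTop 0, fast_bigO q a T hq ha] with s h1 h2 h3 h4 h5
    exact ⟨h4, h1, h2, h5, h3⟩
  obtain ⟨N, hN⟩ := eventually_atTop.1 hev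
  have hN0 := (hN N le_rfl).1
  obtain ⟨d, hd1, hd2⟩ := fixed_point_ode (fun s d => f (X s) - g (X s + d)) N c p D R hN0 hc0 hc2 hR0
    hDR (by
      have hXc : ContinuousOn X (Set.Ici N) := fun s hs =>
        (hN s hs).2.1.continuousAt.continuousWithinAt
      have hX1 : ContinuousOn (fun z : ℝ × E => X z.1) (Set.Ici N ×ˢ Set.univ) :=
        hXc.comp continuousOn_fst (fun z hz => hz.1)
      exact (hfc.comp_continuousOn hX1).sub (hgc.comp_continuousOn (hX1.add continuousOn_snd)))
    (by
      intro s hs d₁ d₂ h1 h2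
      obtain ⟨hs0, -, hXs, -, hrs⟩ := hN s hs
      obtain ⟨hr1, hr2⟩ := hrs _ rfl
      set r := (a * (T + s)) ^ (-q) + R * s ^ (-p)
      have k1 : ‖X s + d₁‖ ≤ r := (norm_add_le _ _).trans (add_le_add hXs h1)
      have k2 : ‖X s + d₂‖ ≤ r := (norm_add_le _ _).trans (add_le_add hXs h2)
      have hm : max ‖X s + d₂‖ ‖X s + d₁‖ ≤ r := max_le k2 k1
      have k3 := hg _ _ (k2.trans hr1) (k1.trans hr1)
      rw [add_sub_add_left_eq_sub, norm_sub_rev d₂ d₁] at k3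
      rw [sub_sub_sub_cancel_left]
      refine k3.trans ?_
      gcongr
      refine le_trans ?_ hr2
      gcongr)
    (by
      intro s hs
      obtain ⟨hs0, -, hXs, hXA, hrs⟩ := hN s hs
      obtain ⟨hr1, hr2⟩ := hrs _ rfl
      have hX1 : ‖X s‖ ≤ 1 := by
        refine hXs.trans (le_trans ?_ hr1)
        have : 0 ≤ R * s ^ (-p) := by positivity
        linarith
      simp only [add_zero]
      refine (hfg _ hX1).trans ?_
      calc K' * ‖X s‖ ^ n ≤ K' * (A * s ^ (-q)) ^ n := by gcongr; exact hXs.trans hXA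
        _ = D * (s ^ (-q)) ^ n := by rw [hD]; ring
        _ = _ := by
          rw [← Real.rpow_natCast (s ^ (-q)), ← Real.rpow_mul hs0.le]
          congr 2
          linarith)
  refine ⟨fun s => X s + d s, R, hR0, ?_, ?_⟩
  · filter_upwards [eventually_gt_atTop N] with s hs
    have := (hN s hs.le).2.1.add (hd1 s hs)
    rw [show f (X s) + -(f (X s) - g (X s + d s)) = g (X s + d s) by abel] at this
    exact this
  · filter_upwards [eventually_gt_atTop N] with s hs
    simpa using hd2 s hs.le

/-- The quantitative facts about the gradient field used below. -/
structure GoodField {P : ℕ} (κ j : ℕ) (B b K : ℝ)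
    (g : EuclideanSpace ℝ (Fin P) → EuclideanSpace ℝ (Fin P)) : Prop where
  cont : Continuous g
  zero : g 0 = 0
  lip : ∀ u v, ‖u‖ ≤ 1 → ‖v‖ ≤ 1 → ‖g u - g v‖ ≤
      (B * max ‖u‖ ‖v‖ ^ κ + K * max ‖u‖ ‖v‖ ^ j) * ‖u - v‖
  size : ∀ u, ‖u‖ ≤ 1 → ‖g u‖ ≤ (b * ‖u‖ ^ κ + K * ‖u‖ ^ j) * ‖u‖

theorem goodField_of {P k m : ℕ} (hk : 2 < k) (hkm : k < m)
    (H e : EuclideanSpace ℝ (Fin P) → ℝ)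
    (hH : ContDiff ℝ ⊤ H)
    (hhom : ∀ α : ℝ, 0 < α → ∀ θ : EuclideanSpace ℝ (Fin P), H (α • θ) = α ^ k * H θ)
    (hes : ContDiff ℝ (⊤ : ℕ∞) e)
    (hev : ∀ n : ℕ, n ≤ m - 1 → iteratedFDeriv ℝ n e 0 = 0) :
    ∃ K : ℝ, 0 ≤ K ∧ GoodField (k - 2) (m - 2) (k * (k - 1) * supSphere H) (k * supSphere H) K
      (gradient (H + e)) ∧
      ∀ u, ‖u‖ ≤ 1 → ‖gradient (H + e) u - gradient H u‖ ≤ K * ‖u‖ ^ (m - 1) := by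
  obtain ⟨hH1, hH2⟩ := fderiv_bounds_H hk H hH hhom
  obtain ⟨he0, K, hK0, hK⟩ := fderiv_bounds_e (by omega : 3 < m) e hes hev
  have hH' : ContDiff ℝ (⊤ : ℕ∞) H := hH.of_le le_top
  have hHd : Differentiable ℝ H := hH'.differentiable (by simp)
  have hed : Differentiable ℝ e := hes.differentiable (by simp)
  have hadd : ∀ u, fderiv ℝ (H + e) u = fderiv ℝ H u + fderiv ℝ e u := fun u =>
    fderiv_add (hHd u) (hed u)
  have hgn : ∀ (F : EuclideanSpace ℝ (Fin P) → ℝ) u, ‖gradient F u‖ = ‖fderiv ℝ F u‖ := by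
    intro F u
    simp [gradient]
  have hgs : ∀ (F G : EuclideanSpace ℝ (Fin P) → ℝ) u v,
      ‖gradient F u - gradient G v‖ = ‖fderiv ℝ F u - fderiv ℝ G v‖ := by
    intro F G u v
    simp only [gradient]
    rw [← map_sub, LinearIsometryEquiv.norm_map]
  have heK : ∀ u, ‖u‖ ≤ 1 → ‖fderiv ℝ e u‖ ≤ K * ‖u‖ ^ (m - 2) * ‖u‖ := by
    intro u hu
    have := hK u 0 hu (by simp)
    simpa [he0] using this
  have hH0 : fderiv ℝ H 0 = 0 := by
    have := hH1 0
    rw [norm_zero, zero_pow (by omega), mul_zero] at this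
    exact norm_le_zero_iff.1 this
  refine ⟨K, hK0, ⟨?_, ?_, ?_, ?_⟩, ?_⟩
  · have h1 : Continuous (fderiv ℝ (H + e)) := (hH'.add hes).continuous_fderiv (by simp)
    exact (LinearIsometryEquiv.continuous _).comp h1
  · rw [← norm_eq_zero, hgn, hadd, hH0, he0]; simp
  · intro u v hu hv
    rw [hgs, hadd, hadd, add_sub_add_comm]
    refine (norm_add_le _ _).trans ?_
    rw [add_mul]
    exact add_le_add (hH2 u v) (hK u v hu hv)
  · intro u hu
    rw [hgn, hadd]
    refine (norm_add_le _ _).trans ?_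
    rw [add_mul]
    refine add_le_add ((hH1 u).trans (le_of_eq ?_)) (heK u hu)
    rw [show k - 1 = (k - 2) + 1 by omega, pow_succ]; ring
  · intro u hu
    rw [hgs, hadd, add_sub_cancel_left]
    refine (heK u hu).trans (le_of_eq ?_)
    rw [mul_assoc, ← pow_succ]
    congr 2; omega

theorem fast_iff {P k : ℕ} (hk : 2 < k) (F : EuclideanSpace ℝ (Fin P) → ℝ) (s₀ : ℝ) (hs : 0 < s₀)
    (x : ℝ → EuclideanSpace ℝ (Fin P)) :
    x ∈ FastPathsDeep k F s₀ ↔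
      (∀ᶠ s in atTop, HasDerivAt (fun s => x (-s)) (gradient F (x (-s))) s) ∧
      ∃ T : ℝ, ∀ᶠ s in atTop, ‖x (-s)‖ ≤
        (s₀ * ((k : ℝ) - 2) * (T + s)) ^ (-(1 / (((k - 2 : ℕ) : ℝ)))) := by
  have hcast : (((k - 2 : ℕ) : ℝ)) = (k : ℝ) - 2 := by
    rw [Nat.cast_sub (by omega)]; simp
  have hk0 : (0:ℝ) < (k : ℝ) - 2 := by
    have : (2:ℝ) < k := by exact_mod_cast hk
    linarith
  rw [hcast]
  constructor
  · rintro ⟨⟨⟨T, hT⟩, -⟩, T', hT'⟩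
    refine ⟨?_, T', ?_⟩
    · filter_upwards [eventually_gt_atTop (-T)] with s hs
      have := (hT (-s) (by linarith)).scomp s (hasDerivAt_neg s)
      simpa [Function.comp_def] using this
    · filter_upwards [tendsto_neg_atTop_atBot.eventually hT'] with s hs
      rwa [sub_neg_eq_add] at hs
  · rintro ⟨h1, T', hT'⟩
    refine ⟨⟨?_, ?_⟩, T', ?_⟩
    · obtain ⟨N, hN⟩ := eventually_atTop.1 h1
      refine ⟨-N, fun t ht => ?_⟩
      have h2 := hN (-t) (by linarith)
      have := h2.scomp t (hasDerivAt_neg t)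
      simpa [Function.comp_def] using this
    · have h3 : Tendsto (fun s : ℝ => (s₀ * ((k : ℝ) - 2) * (T' + s)) ^ (-(1 / ((k : ℝ) - 2))))
          atTop (nhds 0) :=
        (tendsto_rpow_neg_atTop (by positivity)).comp
          ((tendsto_atTop_add_const_left _ T' tendsto_id).const_mul_atTop (by positivity))
      have h4 : Tendsto (fun s => x (-s)) atTop (nhds 0) := squeeze_zero_norm' hT' h3
      have := h4.comp tendsto_neg_atBot_atTop
      simpa [Function.comp_def] using this
    · filter_upwards [tendsto_neg_atBot_atTop.eventually hT'] with t ht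
      rw [neg_neg] at ht
      rwa [sub_eq_add_neg]

theorem fast_congr {P k : ℕ} (hk : 2 < k) (F : EuclideanSpace ℝ (Fin P) → ℝ) (s₀ : ℝ) (hs : 0 < s₀)
    (x : ℝ → EuclideanSpace ℝ (Fin P)) (hx : x ∈ FastPathsDeep k F s₀)
    (y : ℝ → EuclideanSpace ℝ (Fin P)) (hy : y =ᶠ[atBot] x) : y ∈ FastPathsDeep k F s₀ := by
  rw [fast_iff hk F s₀ hs] at hx ⊢
  obtain ⟨h1, T, h2⟩ := hx
  obtain ⟨N, hN⟩ := eventually_atBot.1 hy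
  refine ⟨?_, T, ?_⟩
  · filter_upwards [h1, eventually_gt_atTop (-N)] with s hs hsN
    have h3 : (fun s => y (-s)) =ᶠ[nhds s] fun s => x (-s) := by
      filter_upwards [lt_mem_nhds hsN] with u hu
      exact hN _ (by linarith)
    rw [hN (-s) (by linarith)]
    exact hs.congr_of_eventuallyEq h3
  · filter_upwards [h2, eventually_gt_atTop (-N)] with s hs hsN
    rwa [hN (-s) (by linarith)]

theorem rel_iff {E : Type} [NormedAddCommGroup E] (x y : ℝ → E) (p : ℝ) :
    ((fun t => ‖x t - y t‖) =O[atBot] fun t => (-t) ^ (-p)) ↔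
      ∃ R : ℝ, ∀ᶠ s in atTop, ‖x (-s) - y (-s)‖ ≤ R * s ^ (-p) := by
  rw [isBigO_iff]
  constructor
  · rintro ⟨R, hR⟩
    refine ⟨R, ?_⟩
    filter_upwards [tendsto_neg_atTop_atBot.eventually hR, eventually_gt_atTop 0] with s hs hs0
    rw [neg_neg, norm_norm, Real.norm_of_nonneg (by positivity)] at hs
    exact hs
  · rintro ⟨R, hR⟩
    refine ⟨R, ?_⟩
    filter_upwards [tendsto_neg_atBot_atTop.eventually hR, eventually_lt_atBot 0] with t ht ht0
    rw [neg_neg] at ht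
    have : 0 < -t := by linarith
    rw [norm_norm, Real.norm_of_nonneg (by positivity)]
    exact ht

theorem eventuallyEq_of_neg {E : Type} (x y : ℝ → E) (h : ∀ᶠ s in atTop, x (-s) = y (-s)) :
    x =ᶠ[atBot] y := by
  filter_upwards [tendsto_neg_atBot_atTop.eventually h] with t ht
  simpa using ht

theorem fast_unique {P k j : ℕ} (hk : 2 < k) (hj : k - 2 < j) (F : EuclideanSpace ℝ (Fin P) → ℝ)
    (s₀ p B b K : ℝ) (hs : 0 < s₀) (hB : 0 ≤ B) (hK : 0 ≤ K)
    (hBp : B / (s₀ * ((k : ℝ) - 2)) < p) (hF : GoodField (k - 2) j B b K (gradient F))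
    (x y : ℝ → EuclideanSpace ℝ (Fin P)) (hx : x ∈ FastPathsDeep k F s₀)
    (hy : y ∈ FastPathsDeep k F s₀)
    (hxy : (fun t => ‖x t - y t‖) =O[atBot] fun t => (-t) ^ (-p)) : x =ᶠ[atBot] y := by
  rw [fast_iff hk F s₀ hs] at hx hy
  rw [rel_iff] at hxy
  obtain ⟨hx1, T₁, hx2⟩ := hx
  obtain ⟨hy1, T₂, hy2⟩ := hy
  obtain ⟨R, hR⟩ := hxy
  have hk0 : (0:ℝ) < (k : ℝ) - 2 := by
    have : (2:ℝ) < k := by exact_mod_cast hk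
    linarith
  apply eventuallyEq_of_neg
  exact path_unique (k - 2) j (by omega) hj (gradient F) (fun s => x (-s)) (fun s => y (-s))
    (s₀ * ((k : ℝ) - 2)) T₁ T₂ R p B K (by positivity) hBp hB hK hx1 hy1 hx2 hy2 hR
    (Eventually.of_forall fun s h1 h2 => hF.lip _ _ h1 h2)

theorem fast_zero {P k j : ℕ} (hk : 2 < k) (hj : k - 2 < j) (F : EuclideanSpace ℝ (Fin P) → ℝ)
    (s₀ B b K : ℝ) (hs : 0 < s₀) (hb : 0 ≤ b) (hK : 0 ≤ K)
    (hbs : b < s₀) (hF : GoodField (k - 2) j B b K (gradient F))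
    (x : ℝ → EuclideanSpace ℝ (Fin P)) (hx : x ∈ FastPathsDeep k F s₀) :
    x =ᶠ[atBot] 0 := by
  rw [fast_iff hk F s₀ hs] at hx
  obtain ⟨hx1, T₁, hx2⟩ := hx
  have hk0 : (0:ℝ) < (k : ℝ) - 2 := by
    have : (2:ℝ) < k := by exact_mod_cast hk
    linarith
  have hcast : (((k - 2 : ℕ) : ℝ)) = (k : ℝ) - 2 := by
    rw [Nat.cast_sub (by omega)]; simp
  have ha : 0 < s₀ * ((k : ℝ) - 2) := by positivity
  have hq : 0 < 1 / ((k - 2 : ℕ) : ℝ) := by rw [hcast]; positivity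
  apply eventuallyEq_of_neg
  refine path_unique (k - 2) j (by omega) hj (gradient F) (fun s => x (-s)) (fun s => 0)
    (s₀ * ((k : ℝ) - 2)) T₁ T₁ ((s₀ * ((k : ℝ) - 2) / 2) ^ (-(1 / ((k - 2 : ℕ) : ℝ))))
    (1 / ((k - 2 : ℕ) : ℝ)) b K ha ?_ hb hK hx1 ?_ hx2 ?_ ?_ ?_
  · rw [hcast, div_lt_div_iff₀ ha hk0, one_mul]
    gcongr
  · refine Eventually.of_forall fun s => ?_
    rw [hF.zero]; exact hasDerivAt_const _ _
  · filter_upwards [hx2] with s hs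
    rw [norm_zero]; exact (norm_nonneg _).trans hs
  · filter_upwards [hx2, fast_bigO _ _ T₁ hq ha] with s h1 h2
    rw [sub_zero]; exact h1.trans h2
  · refine Eventually.of_forall fun s h1 _ => ?_
    rw [hF.zero, sub_zero, sub_zero, norm_zero, max_eq_left (norm_nonneg _)]
    exact hF.size _ h1

theorem zero_fast {P k : ℕ} (hk : 2 < k) (F : EuclideanSpace ℝ (Fin P) → ℝ) (s₀ : ℝ) (hs : 0 < s₀)
    (hF : gradient F 0 = 0) : (0 : ℝ → EuclideanSpace ℝ (Fin P)) ∈ FastPathsDeep k F s₀ := by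
  have hk0 : (0:ℝ) < (k : ℝ) - 2 := by
    have : (2:ℝ) < k := by exact_mod_cast hk
    linarith
  rw [fast_iff hk F s₀ hs]
  refine ⟨Eventually.of_forall fun s => ?_, 0, ?_⟩
  · simp only [Pi.zero_apply, hF]
    exact hasDerivAt_const _ _
  · filter_upwards [eventually_gt_atTop 0] with s hs
    simp only [Pi.zero_apply, norm_zero]
    apply Real.rpow_nonneg
    rw [zero_add]; positivity

theorem fast_exists {P k m : ℕ} (hk : 2 < k) (hkm : k < m) (F G : EuclideanSpace ℝ (Fin P) → ℝ)
    (s₀ B M K K' : ℝ) (hs : 0 < s₀) (hM : 0 ≤ M) (hBM : B = k * (k - 1) * M)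
    (hK : 0 ≤ K) (hK' : 0 ≤ K')
    (hs₀ : B / ((m : ℝ) - (k : ℝ) + 1) < s₀)
    (hF : GoodField (k - 2) (m - 2) B (k * M) K (gradient F))
    (hG : GoodField (k - 2) (m - 2) B (k * M) K (gradient G))
    (hFG : ∀ u, ‖u‖ ≤ 1 → ‖gradient F u - gradient G u‖ ≤ K' * ‖u‖ ^ (m - 1))
    (x : ℝ → EuclideanSpace ℝ (Fin P)) (hx : x ∈ FastPathsDeep k F s₀) :
    ∃ y ∈ FastPathsDeep k G s₀, (fun t => ‖x t - y t‖) =O[atBot]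
          fun t => (-t) ^ (-(((m : ℝ) - (k : ℝ) + 1) / ((k : ℝ) - 2))) := by
  have hk2 : (2:ℝ) < k := by exact_mod_cast hk
  have hkm' : (k:ℝ) + 1 ≤ m := by exact_mod_cast hkm
  have hk0 : (0:ℝ) < (k : ℝ) - 2 := by linarith
  have hmk0 : (0:ℝ) < (m : ℝ) - k + 1 := by linarith
  by_cases hcase : k * M < s₀
  · have h0 := fast_zero hk (by omega) F s₀ B (k * M) K hs (by positivity) hK hcase hF x hx
    refine ⟨0, zero_fast hk G s₀ hs hG.zero, ?_⟩
    rw [rel_iff]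
    refine ⟨0, ?_⟩
    filter_upwards [tendsto_neg_atTop_atBot.eventually h0] with s hs
    simp [hs]
  · push Not at hcase
    have hcast : (((k - 2 : ℕ) : ℝ)) = (k : ℝ) - 2 := by
      rw [Nat.cast_sub (by omega)]; simp
    have hB0 : 0 ≤ B := by
      rw [hBM]
      have : (0:ℝ) ≤ k - 1 := by linarith
      positivity
    have hM0 : 0 < (k:ℝ) * M := lt_of_lt_of_le hs hcase
    set p := ((m : ℝ) - (k : ℝ) + 1) / ((k : ℝ) - 2) with hp
    have ha : 0 < s₀ * ((k : ℝ) - 2) := by positivity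
    have hBp : B / (s₀ * ((k : ℝ) - 2)) < p := by
      rw [div_lt_iff₀ hmk0] at hs₀
      rw [hp, div_lt_div_iff₀ ha hk0]
      nlinarith
    have hpq : 1 / ((k : ℝ) - 2) + 1 ≤ p := by
      rw [div_lt_iff₀ hmk0, hBM] at hs₀
      have h1 : (k:ℝ) * M * (k - 1) < k * M * (m - k + 1) := by
        calc (k:ℝ) * M * (k - 1) = k * (k - 1) * M := by ring
          _ < s₀ * (m - k + 1) := hs₀
          _ ≤ _ := by gcongr
      have h2 : (k:ℝ) - 1 < m - k + 1 := lt_of_mul_lt_mul_left h1 hM0.le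
      rw [hp, div_add_one hk0.ne']
      exact div_le_div_of_nonneg_right (by linarith) hk0.le
    have hx' := hx
    rw [fast_iff hk F s₀ hs] at hx'
    obtain ⟨hx1, T, hx2⟩ := hx'
    obtain ⟨Y, R, hR, hY1, hY2⟩ := path_exists (k - 2) (m - 2) (m - 1) (by omega) (by omega)
      (gradient F) (gradient G) (fun s => x (-s)) (s₀ * ((k : ℝ) - 2)) T p B K K' ha
      (by rw [hcast]; linarith)
      (by
        rw [hcast, hp, Nat.cast_sub (by omega)]
        field_simp
        push_cast
        ring)
      hBp hB0 hK hK' hF.cont hG.cont hx1 hx2 hFG hG.lip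
    obtain ⟨T', hT'⟩ := fast_perturb (1 / ((k - 2 : ℕ) : ℝ)) (s₀ * ((k : ℝ) - 2)) T R p
      (by rw [hcast]; positivity) ha (by rw [hcast]; exact hpq) hR
    refine ⟨fun t => Y (-t), ?_, ?_⟩
    · rw [fast_iff hk G s₀ hs]
      simp only [neg_neg]
      refine ⟨hY1, T', ?_⟩
      filter_upwards [hY2, hx2, hT'] with s h1 h2 h3
      have h4 : ‖Y s‖ ≤ ‖x (-s)‖ + ‖Y s - x (-s)‖ := by
        simpa using norm_add_le (x (-s)) (Y s - x (-s))
      linarith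
    · rw [rel_iff]
      refine ⟨R, ?_⟩
      filter_upwards [hY2] with s h1
      rw [neg_neg, norm_sub_rev]; exact h1

/-- **Bijection between fast escaping paths, deep case (`k > 2`).**
Let `C = H + e` be a `(k,m)`-approximately homogeneous cost with `H` a `k`-homogeneous
polynomial, `k > 2`. For every `s₀ > k(k-1)‖H‖_∞/(m-k+1)` there is a unique (up to
eventual equality at `-∞`) bijection `Ψ : 𝓕_H(s₀) → 𝓕_C(s₀)` with
`‖x(t) - Ψ(x)(t)‖ = O((-t)^{-(m-k+1)/(k-2)})` as `t → -∞` for every `x ∈ 𝓕_H(s₀)`. -/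
theorem bijection_fast_escape_paths_deep
    (P k m : ℕ) (hk : 2 < k) (hkm : k < m)
    (H e C : EuclideanSpace ℝ (Fin P) → ℝ)
    (hpoly : ∃ p : MvPolynomial (Fin P) ℝ, ∀ x, H x = MvPolynomial.eval (fun i => x i) p)
    (hhom : ∀ α : ℝ, 0 < α → ∀ θ : EuclideanSpace ℝ (Fin P), H (α • θ) = α ^ k * H θ)
    (hes : ContDiff ℝ (⊤ : ℕ∞) e)
    (hev : ∀ n : ℕ, n ≤ m - 1 → iteratedFDeriv ℝ n e 0 = 0)
    (hC : C = H + e)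
    (s₀ : ℝ) (hs₀ : (k : ℝ) * ((k : ℝ) - 1) * supSphere H / ((m : ℝ) - (k : ℝ) + 1) < s₀) :
    ∃ Ψ : (ℝ → EuclideanSpace ℝ (Fin P)) → (ℝ → EuclideanSpace ℝ (Fin P)),
      Set.BijOn Ψ (FastPathsDeep k H s₀) (FastPathsDeep k C s₀) ∧
      (∀ x ∈ FastPathsDeep k H s₀,
        (fun t => ‖x t - Ψ x t‖) =O[atBot]
          fun t => (-t) ^ (-(((m : ℝ) - (k : ℝ) + 1) / ((k : ℝ) - 2)))) ∧
      ∀ Ψ' : (ℝ → EuclideanSpace ℝ (Fin P)) → (ℝ → EuclideanSpace ℝ (Fin P)),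
        Set.BijOn Ψ' (FastPathsDeep k H s₀) (FastPathsDeep k C s₀) →
        (∀ x ∈ FastPathsDeep k H s₀,
          (fun t => ‖x t - Ψ' x t‖) =O[atBot]
            fun t => (-t) ^ (-(((m : ℝ) - (k : ℝ) + 1) / ((k : ℝ) - 2)))) →
        ∀ x ∈ FastPathsDeep k H s₀, Ψ' x =ᶠ[atBot] Ψ x := by
  obtain ⟨q, hq⟩ := hpoly
  have hH : ContDiff ℝ ⊤ H := by
    have : H = fun x => MvPolynomial.eval (fun i => x i) q := funext hq
    rw [this]; exact poly_contDiff q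
  have hk2 : (2:ℝ) < k := by exact_mod_cast hk
  have hkm' : (k:ℝ) + 1 ≤ m := by exact_mod_cast hkm
  have hk0 : (0:ℝ) < (k : ℝ) - 2 := by linarith
  have hk1 : (0:ℝ) ≤ (k : ℝ) - 1 := by linarith
  have hmk0 : (0:ℝ) < (m : ℝ) - k + 1 := by linarith
  have hM := supSphere_nonneg H
  set B : ℝ := (k : ℝ) * ((k : ℝ) - 1) * supSphere H with hB
  have hB0 : 0 ≤ B := by positivity
  have hs : 0 < s₀ := lt_of_le_of_lt (by positivity) hs₀
  set p := ((m : ℝ) - (k : ℝ) + 1) / ((k : ℝ) - 2) with hp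
  have ha : 0 < s₀ * ((k : ℝ) - 2) := by positivity
  have hBp : B / (s₀ * ((k : ℝ) - 2)) < p := by
    have hs₁ := hs₀
    rw [div_lt_iff₀ hmk0] at hs₁
    rw [hp, div_lt_div_iff₀ ha hk0]
    nlinarith
  obtain ⟨K, hK, hCg, hdiff⟩ := goodField_of hk hkm H e hH hhom hes hev
  rw [← hC] at hCg hdiff
  obtain ⟨K₀, hK₀, hHg, -⟩ := goodField_of hk hkm H 0 hH hhom contDiff_const
    (by intro n _; rw [iteratedFDeriv_zero]; rfl)
  rw [add_zero] at hHg
  have mono : ∀ (K₁ : ℝ) (g : EuclideanSpace ℝ (Fin P) → EuclideanSpace ℝ (Fin P)),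
      K₁ ≤ max K K₀ → GoodField (k - 2) (m - 2) B (k * supSphere H) K₁ g →
      GoodField (k - 2) (m - 2) B (k * supSphere H) (max K K₀) g := by
    intro K₁ g h1 h2
    refine ⟨h2.cont, h2.zero, fun u v hu hv => (h2.lip u v hu hv).trans ?_,
      fun u hu => (h2.size u hu).trans ?_⟩ <;> gcongr
  have hCg' := mono K _ (le_max_left _ _) hCg
  have hHg' := mono K₀ _ (le_max_right _ _) hHg
  have hKK : 0 ≤ max K K₀ := hK.trans (le_max_left _ _)
  have hsymm : ∀ x y : ℝ → EuclideanSpace ℝ (Fin P),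
      ((fun t => ‖x t - y t‖) =O[atBot] fun t => (-t) ^ (-p)) →
      ((fun t => ‖y t - x t‖) =O[atBot] fun t => (-t) ^ (-p)) := by
    intro x y h
    simpa only [norm_sub_rev] using h
  refine germ_bijection (FastPathsDeep k H s₀) (FastPathsDeep k C s₀)
    (fun x y => (fun t => ‖x t - y t‖) =O[atBot] fun t => (-t) ^ (-p)) hsymm ?_ ?_
    (fast_congr hk H s₀ hs) (fast_congr hk C s₀ hs) ?_ ?_ ?_ ?_
  · intro x y z h1 h2
    have h3 := h1.norm_left.of_norm_left.add h2
    refine IsBigO.trans (IsBigO.of_bound 1 (Eventually.of_forall fun t => ?_)) h3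
    rw [norm_norm, one_mul, Real.norm_of_nonneg (by positivity)]
    exact norm_sub_le_norm_sub_add_norm_sub _ _ _
  · intro x y h
    have h0 : (fun t => ‖x t - y t‖) =ᶠ[atBot] fun _ => (0:ℝ) := by
      filter_upwards [h] with t ht
      simp [ht]
    exact h0.trans_isBigO (isBigO_zero _ _)
  · intro x hx
    exact fast_exists hk hkm H C s₀ B (supSphere H) _ K hs hM rfl hKK hK hs₀ hHg' hCg'
      (fun u hu => by rw [norm_sub_rev]; exact hdiff u hu) x hx
  · intro y hy
    obtain ⟨x, hx, hr⟩ := fast_exists hk hkm C H s₀ B (supSphere H) _ K hs hM rfl hKK hK hs₀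
      hCg' hHg' hdiff y hy
    exact ⟨x, hx, hsymm _ _ hr⟩
  · intro x hx y hy h
    exact fast_unique hk (by omega) H s₀ p B _ _ hs hB0 hKK hBp hHg' x y hx hy h
  · intro x hx y hy h
    exact fast_unique hk (by omega) C s₀ p B _ _ hs hB0 hKK hBp hCg' x y hx hy h
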